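/- For all integers i ≥ 1 and k ≥ 2, (∑_{m=1}^∞ J_{2i}(m)·σ_{i+k}(m)/m^{3i+2k}) · ζ(2i+2k) = (∑_{m=1}^∞ J_i(m)·σ_i(m)/m^{2i+k}) · ζ(i+2k). -/

import Mathlib

/-- Jordan totient `J_k(m) = ∑_{d ∣ m} μ(m/d) d^k`. -/
def jordanTotient (k m : ℕ) : ℤ :=
  ∑ d ∈ m.divisors, ArithmeticFunction.moebius (m / d) * (d : ℤ) ^ k

open ArithmeticFunction in
theorem jordanTotient_eq_moebius_mul_pow {k : ℕ} (hk : k ≠ 0) (m : ℕ) :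
    jordanTotient k m = (moebius * ((pow k : ArithmeticFunction ℕ) : ArithmeticFunction ℤ)) m := by
  rw [ArithmeticFunction.mul_apply, jordanTotient,
    ← Nat.sum_divisorsAntidiagonal' (fun x y => moebius x * (y : ℤ) ^ k)]
  simp [hk]

open ArithmeticFunction in
theorem isMultiplicative_moebius_mul_pow (k : ℕ) :
    (moebius * ((pow k : ArithmeticFunction ℕ) : ArithmeticFunction ℤ)).IsMultiplicative :=
  isMultiplicative_moebius.mul isMultiplicative_pow.natCast

open ArithmeticFunction in
theorem sum_divisors_jordanTotient {k : ℕ} (hk : k ≠ 0) (m : ℕ) :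
    ∑ d ∈ m.divisors, jordanTotient k d = (m : ℤ) ^ k := by
  simp_rw [jordanTotient_eq_moebius_mul_pow hk]
  rw [← coe_zeta_mul_apply, ← mul_assoc, coe_zeta_mul_moebius, one_mul]
  simp [hk]

theorem jordanTotient_zero_right (k : ℕ) : jordanTotient k 0 = 0 := by
  simp [jordanTotient]

theorem jordanTotient_one_right (k : ℕ) : jordanTotient k 1 = 1 := by
  simp [jordanTotient]

theorem jordanTotient_mul_of_coprime {k : ℕ} (hk : k ≠ 0) {m n : ℕ} (h : m.Coprime n) :
    jordanTotient k (m * n) = jordanTotient k m * jordanTotient k n := by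
  simp_rw [jordanTotient_eq_moebius_mul_pow hk]
  exact (isMultiplicative_moebius_mul_pow k).2 h

theorem jordanTotient_prime_pow_succ {k : ℕ} (hk : k ≠ 0) {p : ℕ} (hp : p.Prime) (e : ℕ) :
    jordanTotient k (p ^ (e + 1)) = ((p : ℤ) ^ (e + 1)) ^ k - ((p : ℤ) ^ e) ^ k := by
  have h₁ := sum_divisors_jordanTotient hk (p ^ (e + 1))
  have h₀ := sum_divisors_jordanTotient hk (p ^ e)
  rw [Nat.sum_divisors_prime_pow hp] at h₀ h₁
  rw [Finset.sum_range_succ, h₀] at h₁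
  push_cast at h₁
  linarith

theorem jordanTotient_nonneg {k : ℕ} (hk : k ≠ 0) (m : ℕ) : 0 ≤ jordanTotient k m := by
  induction m using Nat.recOnPosPrimePosCoprime with
  | zero => simp [jordanTotient_zero_right]
  | one => simp [jordanTotient_one_right]
  | prime_pow p n hp hn =>
    obtain ⟨e, rfl⟩ := Nat.exists_eq_add_one_of_ne_zero hn.ne'
    rw [jordanTotient_prime_pow_succ hk hp, sub_nonneg]
    have : (1 : ℤ) ≤ p := mod_cast hp.one_le
    gcongr
    omega
  | coprime a b _ _ h iha ihb =>
    rw [jordanTotient_mul_of_coprime hk h]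
    positivity

theorem jordanTotient_le_pow {k : ℕ} (hk : k ≠ 0) (m : ℕ) : jordanTotient k m ≤ (m : ℤ) ^ k := by
  rcases eq_or_ne m 0 with rfl | hm
  · simp [jordanTotient_zero_right, hk]
  rw [← sum_divisors_jordanTotient hk m]
  exact Finset.single_le_sum (fun d _ => jordanTotient_nonneg hk d) (Nat.mem_divisors_self m hm)

open ArithmeticFunction in
theorem summable_sigma_div_pow (b : ℕ) {k : ℕ} (hb : b ≠ 0) (hk : 2 ≤ k) :
    Summable fun m : ℕ => ‖((sigma b m : ℕ) : ℂ) / (m : ℂ) ^ (b + k)‖ := by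
  have hpow : LSeriesSummable
      (fun n => ((pow b : ArithmeticFunction ℕ) : ArithmeticFunction ℂ) n) ((b + k : ℕ) : ℂ) := by
    refine LSeriesSummable_of_le_const_mul_rpow (x := b + 1) ?_ ⟨1, fun n hn => ?_⟩
    · simp only [Complex.natCast_re]
      norm_cast
      omega
    · simp [hb]
  have hzeta : LSeriesSummable
      (fun n => ((zeta : ArithmeticFunction ℕ) : ArithmeticFunction ℂ) n) ((b + k : ℕ) : ℂ) := by
    refine LSeriesSummable_of_le_const_mul_rpow (x := 1) ?_ ⟨1, fun n hn => ?_⟩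
    · simp only [Complex.natCast_re]
      norm_cast
      omega
    · simp [hn]
  have h := (LSeriesSummable_mul hzeta hpow).norm
  rw [← natCoe_mul, zeta_mul_pow_eq_sigma] at h
  refine h.congr fun m => ?_
  rcases eq_or_ne m 0 with rfl | hm
  · simp
  · rw [LSeries.term_of_ne_zero hm, Complex.cpow_natCast, natCoe_apply]

/-- The `m`-th term of the Dirichlet series of `J_a · σ_b` at the point `a + b + k`. -/
noncomputable def jordanSigmaTerm (a b k m : ℕ) : ℂ :=
  (jordanTotient a m : ℂ) * (ArithmeticFunction.sigma b m : ℂ) / (m : ℂ) ^ (a + b + k)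

theorem summable_norm_jordanSigmaTerm {a b k : ℕ} (ha : a ≠ 0) (hb : b ≠ 0) (hk : 2 ≤ k) :
    Summable fun m => ‖jordanSigmaTerm a b k m‖ := by
  refine Summable.of_nonneg_of_le (fun _ => norm_nonneg _) (fun m => ?_)
    (summable_sigma_div_pow b hb hk)
  rcases eq_or_ne m 0 with rfl | hm
  · simp [jordanSigmaTerm]
  have hJ : ‖(jordanTotient a m : ℂ)‖ ≤ (m : ℝ) ^ a := by
    rw [Complex.norm_intCast, abs_of_nonneg (mod_cast jordanTotient_nonneg ha m)]
    exact_mod_cast jordanTotient_le_pow ha m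
  have hm' : (0 : ℝ) < m := by positivity
  rw [jordanSigmaTerm, add_assoc, pow_add, mul_div_mul_comm, norm_mul]
  refine mul_le_of_le_one_left (norm_nonneg _) ?_
  rw [norm_div, norm_pow, Complex.norm_natCast]
  exact div_le_one_of_le₀ hJ (by positivity)

theorem jordanSigmaTerm_mul_of_coprime {a : ℕ} (ha : a ≠ 0) (b k : ℕ) {m n : ℕ}
    (h : m.Coprime n) :
    jordanSigmaTerm a b k (m * n) = jordanSigmaTerm a b k m * jordanSigmaTerm a b k n := by
  simp only [jordanSigmaTerm, jordanTotient_mul_of_coprime ha h,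
    ArithmeticFunction.isMultiplicative_sigma.map_mul_of_coprime h]
  push_cast
  rw [mul_pow, div_mul_div_comm]
  ring

theorem norm_inv_pow_lt_one {p : ℕ} (hp : p.Prime) {n : ℕ} (hn : n ≠ 0) :
    ‖((p : ℂ)⁻¹) ^ n‖ < 1 := by
  rw [norm_pow, norm_inv, Complex.norm_natCast]
  have : (1 : ℝ) < p := mod_cast hp.one_lt
  exact pow_lt_one₀ (by positivity) (inv_lt_one_of_one_lt₀ this) hn

theorem one_sub_inv_pow_ne_zero {p : ℕ} (hp : p.Prime) {n : ℕ} (hn : n ≠ 0) :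
    1 - ((p : ℂ)⁻¹) ^ n ≠ 0 := by
  intro h
  have := norm_inv_pow_lt_one hp hn
  rw [← sub_eq_zero.mp h] at this
  simp at this

theorem sigma_prime_pow_mul {b p : ℕ} (hp : p.Prime) (e : ℕ) :
    (ArithmeticFunction.sigma b (p ^ e) : ℂ) * ((p : ℂ) ^ b - 1) =
      (p : ℂ) ^ b * ((p : ℂ) ^ b) ^ e - 1 := by
  rw [ArithmeticFunction.sigma_apply_prime_pow hp, ← pow_succ', ← geom_sum_mul ((p : ℂ) ^ b)]
  push_cast
  simp_rw [← pow_mul, mul_comm b]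

theorem jordanSigmaTerm_prime_pow {a b k p : ℕ} (ha : a ≠ 0) (hb : b ≠ 0) (hp : p.Prime) (e : ℕ) :
    jordanSigmaTerm a b k (p ^ e) =
      (1 - (p : ℂ)⁻¹ ^ a) / ((p : ℂ) ^ b - 1) *
          ((p : ℂ) ^ b * ((p : ℂ)⁻¹ ^ k) ^ e - ((p : ℂ)⁻¹ ^ (b + k)) ^ e) +
        if e = 0 then (p : ℂ)⁻¹ ^ a else 0 := by
  have hp0 : (p : ℂ) ≠ 0 := mod_cast hp.ne_zero
  have hpb : (p : ℂ) ^ b - 1 ≠ 0 := by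
    rw [sub_ne_zero]
    exact_mod_cast (Nat.one_lt_pow hb hp.one_lt).ne'
  have hσ := (eq_div_iff hpb).mpr (sigma_prime_pow_mul (b := b) hp e)
  rcases e with _ | e
  · simp only [jordanSigmaTerm, pow_zero, jordanTotient_one_right]
    simp
    field_simp
    ring
  · rw [jordanSigmaTerm, hσ, jordanTotient_prime_pow_succ ha hp]
    simp only [Nat.add_eq_zero_iff, one_ne_zero, and_false, if_false, add_zero]
    push_cast
    simp only [inv_pow]
    field_simp
    ring

theorem hasSum_jordanSigmaTerm_prime_pow {a b k p : ℕ} (ha : a ≠ 0) (hb : b ≠ 0) (hk : k ≠ 0)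
    (hp : p.Prime) :
    HasSum (fun e => jordanSigmaTerm a b k (p ^ e))
      ((1 - (p : ℂ)⁻¹ ^ a) / ((1 - (p : ℂ)⁻¹ ^ (b + k)) * (1 - (p : ℂ)⁻¹ ^ k)) +
        (p : ℂ)⁻¹ ^ a) := by
  have hp0 : (p : ℂ) ≠ 0 := mod_cast hp.ne_zero
  have hpb : (p : ℂ) ^ b - 1 ≠ 0 := by
    rw [sub_ne_zero]
    exact_mod_cast (Nat.one_lt_pow hb hp.one_lt).ne'
  have hbk : b + k ≠ 0 := by omega
  have hv := one_sub_inv_pow_ne_zero hp hk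
  have hu := one_sub_inv_pow_ne_zero hp hbk
  have h := ((((hasSum_geometric_of_norm_lt_one (norm_inv_pow_lt_one hp hk)).mul_left
    ((p : ℂ) ^ b)).sub (hasSum_geometric_of_norm_lt_one (norm_inv_pow_lt_one hp hbk))).mul_left
    ((1 - (p : ℂ)⁻¹ ^ a) / ((p : ℂ) ^ b - 1))).add (hasSum_ite_eq 0 ((p : ℂ)⁻¹ ^ a))
  simp_rw [jordanSigmaTerm_prime_pow ha hb hp]
  have hB : (p : ℂ) ^ b * (p : ℂ)⁻¹ ^ (b + k) = (p : ℂ)⁻¹ ^ k := by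
    rw [pow_add, ← mul_assoc, ← mul_pow, mul_inv_cancel₀ hp0, one_pow, one_mul]
  have hclosed : ((1 - (p : ℂ)⁻¹ ^ (b + k)) * (1 - (p : ℂ)⁻¹ ^ k))⁻¹ =
      ((p : ℂ) ^ b * (1 - (p : ℂ)⁻¹ ^ k)⁻¹ - (1 - (p : ℂ)⁻¹ ^ (b + k))⁻¹) /
        ((p : ℂ) ^ b - 1) := by
    generalize (p : ℂ)⁻¹ ^ (b + k) = u at *
    generalize (p : ℂ)⁻¹ ^ k = v at *
    field_simp
    linear_combination hB
  rw [div_eq_mul_inv _ (_ * _), hclosed, ← mul_div_assoc, ← div_mul_eq_mul_div]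
  exact h

theorem hasProd_jordanSigmaTerm {a b k : ℕ} (ha : a ≠ 0) (hb : b ≠ 0) (hk : 2 ≤ k) :
    HasProd (fun p : Nat.Primes =>
      (1 - (p : ℂ)⁻¹ ^ a) / ((1 - (p : ℂ)⁻¹ ^ (b + k)) * (1 - (p : ℂ)⁻¹ ^ k)) + (p : ℂ)⁻¹ ^ a)
      (∑' m : ℕ+, jordanSigmaTerm a b k m) := by
  have h0 : jordanSigmaTerm a b k 0 = 0 := by simp [jordanSigmaTerm, jordanTotient_zero_right]
  have h1 : jordanSigmaTerm a b k 1 = 1 := by simp [jordanSigmaTerm, jordanTotient_one_right]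
  have h := EulerProduct.eulerProduct_hasProd h1 (jordanSigmaTerm_mul_of_coprime ha b k)
    (summable_norm_jordanSigmaTerm ha hb hk) h0
  have hsupp : Function.support (jordanSigmaTerm a b k) ⊆ Set.range ((↑) : ℕ+ → ℕ) := by
    intro m hm
    have hm0 : m ≠ 0 := fun h => hm (h ▸ h0)
    exact ⟨⟨m, Nat.pos_of_ne_zero hm0⟩, rfl⟩
  rw [PNat.coe_injective.tsum_eq hsupp]
  simpa only [fun p : Nat.Primes =>
    (hasSum_jordanSigmaTerm_prime_pow ha hb (by omega : k ≠ 0) p.2).tsum_eq] using h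

theorem riemannZeta_natCast_hasProd {n : ℕ} (hn : 2 ≤ n) :
    HasProd (fun p : Nat.Primes => (1 - (p : ℂ)⁻¹ ^ n)⁻¹) (riemannZeta (n : ℂ)) := by
  have hs : 1 < (n : ℂ).re := by
    rw [Complex.natCast_re]
    exact_mod_cast hn
  simpa only [Complex.cpow_neg, Complex.cpow_natCast, inv_pow] using
    riemannZeta_eulerProduct_hasProd hs

/-- For all integers `i ≥ 1` and `k ≥ 2`,
`(∑ J_{2i}(m)·σ_{i+k}(m)/m^(3i+2k)) · ζ(2i+2k) = (∑ J_i(m)·σ_i(m)/m^(2i+k)) · ζ(i+2k)`. -/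
theorem stmt3 (i k : ℕ) (hi : 1 ≤ i) (hk : 2 ≤ k) :
    (∑' m : ℕ+,
        ((jordanTotient (2 * i) (m : ℕ) : ℤ) : ℂ) *
            ((ArithmeticFunction.sigma (i + k) (m : ℕ) : ℕ) : ℂ) /
          ((m : ℕ) : ℂ) ^ (3 * i + 2 * k)) * riemannZeta ((2 * i + 2 * k : ℕ) : ℂ)
      = (∑' m : ℕ+,
            ((jordanTotient i (m : ℕ) : ℤ) : ℂ) *
                ((ArithmeticFunction.sigma i (m : ℕ) : ℕ) : ℂ) /
              ((m : ℕ) : ℂ) ^ (2 * i + k)) * riemannZeta ((i + 2 * k : ℕ) : ℂ) := by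
  have hL := (hasProd_jordanSigmaTerm (a := 2 * i) (b := i + k) (by omega) (by omega) hk).mul
    (riemannZeta_natCast_hasProd (n := 2 * i + 2 * k) (by omega))
  have hR := (hasProd_jordanSigmaTerm (a := i) (b := i) (by omega) (by omega) hk).mul
    (riemannZeta_natCast_hasProd (n := i + 2 * k) (by omega))
  have hlhs : 2 * i + (i + k) + k = 3 * i + 2 * k := by ring
  have hrhs : i + i + k = 2 * i + k := by ring
  simp only [jordanSigmaTerm, hlhs, hrhs] at hL hR
  refine hL.unique ?_
  convert hR using 2 with p
  have h₁ := one_sub_inv_pow_ne_zero p.2 (n := i + k + k) (by omega)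
  have h₂ := one_sub_inv_pow_ne_zero p.2 (n := k) (by omega)
  have h₃ := one_sub_inv_pow_ne_zero p.2 (n := 2 * i + 2 * k) (by omega)
  have h₄ := one_sub_inv_pow_ne_zero p.2 (n := i + k) (by omega)
  have e₁ : ((p : ℕ) : ℂ)⁻¹ ^ (i + k + k) = (p : ℂ)⁻¹ ^ i * ((p : ℂ)⁻¹ ^ k) ^ 2 := by ring
  have e₂ : ((p : ℕ) : ℂ)⁻¹ ^ (2 * i + 2 * k) = ((p : ℂ)⁻¹ ^ i) ^ 2 * ((p : ℂ)⁻¹ ^ k) ^ 2 := by ring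
  have e₃ : ((p : ℕ) : ℂ)⁻¹ ^ (i + 2 * k) = (p : ℂ)⁻¹ ^ i * ((p : ℂ)⁻¹ ^ k) ^ 2 := by ring
  have e₄ : ((p : ℕ) : ℂ)⁻¹ ^ (i + k) = (p : ℂ)⁻¹ ^ i * (p : ℂ)⁻¹ ^ k := by ring
  have e₅ : ((p : ℕ) : ℂ)⁻¹ ^ (2 * i) = ((p : ℂ)⁻¹ ^ i) ^ 2 := by ring
  rw [e₁] at h₁
  rw [e₂] at h₃
  rw [e₄] at h₄
  rw [e₁, e₂, e₃, e₄, e₅]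
  generalize ((p : ℕ) : ℂ)⁻¹ ^ i = A at *
  generalize ((p : ℕ) : ℂ)⁻¹ ^ k = B at *
  field_simp
  ring
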